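/- The identity ∑_{u,v,w,t,n ≥ 0} B(u,v,w,t,n) a^u b^v c^w d^t q^n = (−aq;q)_∞ (−bq;q)_∞ (−cq;q)_∞ (−dq;q)_∞ holds (as formal power series, or for |q| < 1 and |a|, |b|, |c|, |d| small), where B(u,v,w,t,n) is the number of partitions in E₁ of n with exactly u parts whose color contains a, exactly v parts whose color contains b, exactly w parts whose color contains c, and exactly t parts whose color contains d. -/

import Mathlib

/-- The four primary and six secondary colors, totally ordered by
`ab < ac < ad < a < bc < bd < b < cd < c < d`. -/
inductive C10 : Type
  | ab | ac | ad | a | bc | bd | b | cd | c | d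
  deriving DecidableEq

/-- Index realizing the color order `ab < ac < ad < a < bc < bd < b < cd < c < d`. -/
def C10.idx : C10 → ℕ
  | .ab => 0
  | .ac => 1
  | .ad => 2
  | .a => 3
  | .bc => 4
  | .bd => 5
  | .b => 6
  | .cd => 7
  | .c => 8
  | .d => 9

/-- Whether a color is primary. -/
def C10.primary : C10 → Bool
  | .a => true
  | .b => true
  | .c => true
  | .d => true
  | _ => false

/-- The lexicographic order `≻` on colored parts: `k_p ≻ l_q ↔ k − l ≥ χ(p ≤ q)`. -/
def Succ (x y : ℕ × C10) : Prop :=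
  y.1 + (if x.2.idx ≤ y.2.idx then 1 else 0) ≤ x.1

/-- A colored part belongs to `P ∪ S`: positive size, and size at least 2 if the color is
secondary. -/
def InPS (x : ℕ × C10) : Prop :=
  0 < x.1 ∧ (x.2.primary = false → 2 ≤ x.1)

/-- The relation `≫`: `k_p ≫ l_q` iff `k_p ≽ (l+1)_q` when `p` or `q` is primary;
`k_p ≻ (l+1)_q` when `p, q` are secondary with `(p,q) ∉ {(cd,ab),(ad,bc)}`; and
`k_p ≻ l_q` when `(p,q) ∈ {(cd,ab),(ad,bc)}`. -/
def GG (x y : ℕ × C10) : Prop :=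
  if (x.2 = C10.cd ∧ y.2 = C10.ab) ∨ (x.2 = C10.ad ∧ y.2 = C10.bc) then
    Succ x y
  else if x.2.primary ∨ y.2.primary then
    Succ x (y.1 + 1, y.2) ∨ x = (y.1 + 1, y.2)
  else
    Succ x (y.1 + 1, y.2)

/-- The forbidden patterns `((k+2)_cd, (k+2)_ab, k_c)`, `((k+2)_cd, (k+2)_ab, k_d)` and
`((k+2)_ad, (k+1)_bc, k_a)`, except that `(3_ad, 2_bc, 1_a)` is allowed. -/
def Forbidden (x y z : ℕ × C10) : Prop :=
  (x, y, z) ≠ ((3, C10.ad), (2, C10.bc), (1, C10.a)) ∧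
    ((x.2 = C10.cd ∧ y.2 = C10.ab ∧ x.1 = y.1 ∧ x.1 = z.1 + 2 ∧
        (z.2 = C10.c ∨ z.2 = C10.d)) ∨
      (x.2 = C10.ad ∧ y.2 = C10.bc ∧ x.1 = y.1 + 1 ∧ x.1 = z.1 + 2 ∧ z.2 = C10.a))

/-- Membership in `E₁`: a sequence of parts in `P ∪ S`, decreasing for `≫`, with no three
consecutive parts forming a forbidden pattern. -/
def InE1 (l : List (ℕ × C10)) : Prop :=
  (∀ x ∈ l, InPS x) ∧ l.Chain' GG ∧
    ∀ x y z : ℕ × C10, [x, y, z] <:+: l → ¬ Forbidden x y z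

/-- Colors containing `a`. -/
def C10.hasA : C10 → Bool
  | .a => true
  | .ab => true
  | .ac => true
  | .ad => true
  | _ => false

/-- Colors containing `b`. -/
def C10.hasB : C10 → Bool
  | .b => true
  | .ab => true
  | .bc => true
  | .bd => true
  | _ => false

/-- Colors containing `c`. -/
def C10.hasC : C10 → Bool
  | .c => true
  | .ac => true
  | .bc => true
  | .cd => true
  | _ => false

/-- Colors containing `d`. -/
def C10.hasD : C10 → Bool
  | .d => true
  | .ad => true
  | .bd => true
  | .cd => true
  | _ => false

/-- `B(u,v,w,t,n)`: the number of partitions in `E₁` of `n` with exactly `u`, `v`, `w`, `t`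
parts whose color contains `a`, `b`, `c`, `d` respectively. -/
noncomputable def BE1 (u v w t n : ℕ) : ℕ :=
  Nat.card {l : List (ℕ × C10) // InE1 l ∧ (l.map Prod.fst).sum = n ∧
    l.countP (fun x => x.2.hasA) = u ∧ l.countP (fun x => x.2.hasB) = v ∧
    l.countP (fun x => x.2.hasC) = w ∧ l.countP (fun x => x.2.hasD) = t}

/-- The recurrences satisfied by the generating functions `g k e` of the partitions in `E₁` whose
largest part is at most `k_e`. -/
structure IsE1Recurrence {R : Type*} [CommRing R] (a b c d q : R) (g : ℕ → C10 → R) :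
    Prop where
  zero : ∀ e, g 0 e = 1
  one_ab : g 1 .ab = 1
  one_ac : g 1 .ac = 1
  one_ad : g 1 .ad = 1
  one_bc : g 1 .bc = g 1 .a
  one_bd : g 1 .bd = g 1 .a
  one_cd : g 1 .cd = g 1 .b
  eq_ab : ∀ k, g (k + 2) .ab = g (k + 1) .d + a * b * q ^ (k + 2) * g k .d
  eq_ac : ∀ k, g (k + 2) .ac = g (k + 2) .ab + a * c * q ^ (k + 2) * g (k + 1) .ab
  two_ad : g 2 .ad = g 2 .ac + a * d * q ^ 2 * g 1 .ac
  three_ad : g 3 .ad = g 3 .ac + a * d * q ^ 3 * (g 2 .ac + b * c * q ^ 2 * g 1 .a)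
  eq_ad : ∀ k, g (k + 4) .ad = g (k + 4) .ac +
    a * d * q ^ (k + 4) * (g (k + 3) .ac + b * c * q ^ (k + 3) * g (k + 2) .ad)
  eq_a : ∀ k, g (k + 1) .a = g (k + 1) .ad + a * q ^ (k + 1) * g k .a
  eq_bc : ∀ k, g (k + 2) .bc = g (k + 2) .a + b * c * q ^ (k + 2) * g (k + 1) .a
  eq_bd : ∀ k, g (k + 2) .bd = g (k + 2) .bc + b * d * q ^ (k + 2) * g (k + 1) .bc
  eq_b : ∀ k, g (k + 1) .b = g (k + 1) .bd + b * q ^ (k + 1) * g k .b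
  eq_cd : ∀ k, g (k + 2) .cd = g (k + 2) .b +
    c * d * q ^ (k + 2) * (g (k + 1) .b + a * b * q ^ (k + 2) * g k .cd)
  eq_c : ∀ k, g (k + 1) .c = g (k + 1) .cd + c * q ^ (k + 1) * g k .c
  eq_d : ∀ k, g (k + 1) .d = g (k + 1) .c + d * q ^ (k + 1) * g k .d

namespace IsE1Recurrence

variable {R : Type*} [CommRing R] {a b c d q : R} {g x : ℕ → C10 → R}

lemma cd_add_cd (h : IsE1Recurrence a b c d q g) (k : ℕ) :
    g (k + 3) .cd + a * b * q ^ (k + 4) * g (k + 2) .cd =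
      g (k + 4) .ab - (c + d) * q ^ (k + 3) * g (k + 3) .ab +
        c * d * q ^ (2 * k + 5) * g (k + 2) .ab := by
  linear_combination -(h.eq_ab (k + 2) + h.eq_d (k + 2) + h.eq_c (k + 2))
    - a * b * q ^ (k + 4) * (h.eq_d (k + 1) + h.eq_c (k + 1))
    + (c + d) * q ^ (k + 3) * h.eq_ab (k + 1) - c * d * q ^ (2 * k + 5) * h.eq_ab k
    + c * q ^ (k + 3) * h.eq_d (k + 1) + a * b * q ^ (k + 4) * c * q ^ (k + 2) * h.eq_d k

lemma cd_sub_cd (h : IsE1Recurrence a b c d q g) (k : ℕ) :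
    g (k + 3) .cd - b * q ^ (k + 3) * g (k + 2) .cd =
      g (k + 3) .bd + c * d * q ^ (k + 3) * (g (k + 2) .bd +
        a * b * q ^ (k + 3) * (g (k + 1) .cd - b * q ^ (k + 1) * g k .cd)) := by
  linear_combination h.eq_cd (k + 1) - b * q ^ (k + 3) * h.eq_cd k + h.eq_b (k + 2)
    + c * d * q ^ (k + 3) * h.eq_b (k + 1)

/-- The generating functions for the rotated variables `(b, c, d, a q)` at level `k + 2`,
expressed through those for `(a, b, c, d)`. -/
structure Rotation (a b c d q : R) (g x : ℕ → C10 → R) (k : ℕ) : Prop where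
  eq_ab : (1 + a * q) * x (k + 2) .ab = g (k + 2) .bc
  eq_ac : (1 + a * q) * x (k + 2) .ac = g (k + 2) .bd
  eq_ad : (1 + a * q) * x (k + 2) .ad =
    g (k + 2) .bd + a * b * q ^ (k + 3) * (g (k + 1) .cd - b * q ^ (k + 1) * g k .cd)
  eq_a : (1 + a * q) * x (k + 2) .a = g (k + 2) .b + a * b * q ^ (k + 3) * g (k + 1) .cd
  eq_bc : (1 + a * q) * x (k + 2) .bc = g (k + 2) .cd + a * b * q ^ (k + 3) * g (k + 1) .cd
  eq_b : (1 + a * q) * x (k + 2) .b = g (k + 3) .ac - d * q ^ (k + 2) * g (k + 2) .ac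
  eq_cd : (1 + a * q) * x (k + 2) .cd = g (k + 3) .ad - d * q ^ (k + 2) * g (k + 2) .ad
  eq_c : (1 + a * q) * x (k + 2) .c = g (k + 3) .ad
  eq_d : (1 + a * q) * x (k + 2) .d = g (k + 3) .a

lemma rotation_step (h : IsE1Recurrence a b c d q g) (hx : IsE1Recurrence b c d (a * q) q x)
    {k : ℕ} (r : Rotation a b c d q g x k) (r' : Rotation a b c d q g x (k + 1)) :
    Rotation a b c d q g x (k + 2) := by
  have ab : (1 + a * q) * x (k + 4) .ab = g (k + 4) .bc := by
    linear_combination (1 + a * q) * hx.eq_ab (k + 2) + r'.eq_d + b * c * q ^ (k + 4) * r.eq_d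
      - h.eq_bc (k + 2)
  have ac : (1 + a * q) * x (k + 4) .ac = g (k + 4) .bd := by
    linear_combination (1 + a * q) * hx.eq_ac (k + 2) + ab + b * d * q ^ (k + 4) * r'.eq_ab
      - h.eq_bd (k + 2)
  have ad : (1 + a * q) * x (k + 4) .ad = g (k + 4) .bd +
      a * b * q ^ (k + 5) * (g (k + 3) .cd - b * q ^ (k + 3) * g (k + 2) .cd) := by
    linear_combination (1 + a * q) * hx.eq_ad k + ac + a * b * q ^ (k + 5) * (r'.eq_ac +
      c * d * q ^ (k + 3) * r.eq_ad - h.cd_sub_cd k)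
  have a' : (1 + a * q) * x (k + 4) .a =
      g (k + 4) .b + a * b * q ^ (k + 5) * g (k + 3) .cd := by
    linear_combination (1 + a * q) * hx.eq_a (k + 3) + ad + b * q ^ (k + 4) * r'.eq_a
      - h.eq_b (k + 3)
  have bc : (1 + a * q) * x (k + 4) .bc =
      g (k + 4) .cd + a * b * q ^ (k + 5) * g (k + 3) .cd := by
    linear_combination (1 + a * q) * hx.eq_bc (k + 2) + a' + c * d * q ^ (k + 4) * r'.eq_a
      - h.eq_cd (k + 2)
  have bd : (1 + a * q) * x (k + 4) .bd = g (k + 5) .ab - (c + d) * q ^ (k + 4) * g (k + 4) .ab +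
      c * d * q ^ (2 * k + 7) * g (k + 3) .ab + a * c * q ^ (k + 5) * (g (k + 4) .ab -
      (c + d) * q ^ (k + 3) * g (k + 3) .ab + c * d * q ^ (2 * k + 5) * g (k + 2) .ab) := by
    linear_combination (1 + a * q) * hx.eq_bd (k + 2) + bc + a * c * q ^ (k + 5) * r'.eq_bc
      + h.cd_add_cd (k + 1) + a * c * q ^ (k + 5) * h.cd_add_cd k
  have b' : (1 + a * q) * x (k + 4) .b = g (k + 5) .ac - d * q ^ (k + 4) * g (k + 4) .ac := by
    linear_combination (1 + a * q) * hx.eq_b (k + 3) + bd + c * q ^ (k + 4) * r'.eq_b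
      - h.eq_ac (k + 3) + (c + d) * q ^ (k + 4) * h.eq_ac (k + 2)
      - c * d * q ^ (2 * k + 7) * h.eq_ac (k + 1)
  have cd : (1 + a * q) * x (k + 4) .cd = g (k + 5) .ad - d * q ^ (k + 4) * g (k + 4) .ad := by
    linear_combination (1 + a * q) * hx.eq_cd (k + 2) + b' + a * d * q ^ (k + 5) * (r'.eq_b +
      b * c * q ^ (k + 4) * r.eq_cd) - h.eq_ad (k + 1) + d * q ^ (k + 4) * h.eq_ad k
  have c' : (1 + a * q) * x (k + 4) .c = g (k + 5) .ad := by
    linear_combination (1 + a * q) * hx.eq_c (k + 3) + cd + d * q ^ (k + 4) * r'.eq_c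
  have d' : (1 + a * q) * x (k + 4) .d = g (k + 5) .a := by
    linear_combination (1 + a * q) * hx.eq_d (k + 3) + c' + a * q ^ (k + 5) * r'.eq_d
      - h.eq_a (k + 4)
  exact ⟨ab, ac, ad, a', bc, b', cd, c', d'⟩

lemma level_one (h : IsE1Recurrence a b c d q g) :
    g 1 .a = 1 + a * q ∧ g 1 .b = 1 + a * q + b * q ∧
      g 1 .c = 1 + a * q + b * q + c * q ∧ g 1 .d = 1 + a * q + b * q + c * q + d * q := by
  rw [h.eq_d 0, h.eq_c 0, h.one_cd, h.eq_b 0, h.one_bd, h.eq_a 0, h.one_ad]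
  simp only [h.zero]
  ring_nf
  simp

lemma rotation_zero (h : IsE1Recurrence a b c d q g) (hx : IsE1Recurrence b c d (a * q) q x) :
    Rotation a b c d q g x 0 := by
  obtain ⟨ga, gb, gc, gd⟩ := h.level_one
  obtain ⟨xa, xb, xc, xd⟩ := hx.level_one
  have g1 := h.one_bc; have g3 := h.one_cd
  have x1 := hx.one_bc
  constructor <;>
  simp only [zero_add, h.eq_a 2, h.three_ad, h.eq_ac 1, h.eq_ab 1, h.eq_d 1, h.eq_c 1, h.eq_cd 0,
    h.eq_b 1, h.eq_bd 0, h.eq_bc 0, h.eq_a 1, h.two_ad, h.eq_ac 0, h.eq_ab 0, h.zero,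
    h.one_ab, h.one_ac, ga, gb, gc, gd, g1, g3,
    hx.eq_d 1, hx.eq_c 1, hx.eq_cd 0,
    hx.eq_b 1, hx.eq_bd 0, hx.eq_bc 0, hx.eq_a 1, hx.two_ad, hx.eq_ac 0, hx.eq_ab 0, hx.zero,
    hx.one_ab, hx.one_ac, xa, xb, xc, xd, x1] <;> ring

lemma rotation_one (h : IsE1Recurrence a b c d q g) (hx : IsE1Recurrence b c d (a * q) q x) :
    Rotation a b c d q g x 1 := by
  obtain ⟨ga, gb, gc, gd⟩ := h.level_one
  obtain ⟨xa, xb, xc, xd⟩ := hx.level_one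
  have g1 := h.one_bc; have g3 := h.one_cd
  have x1 := hx.one_bc; have x3 := hx.one_cd
  constructor <;>
  simp only [Nat.reduceAdd, h.eq_a 3, h.eq_ad 0, h.eq_ac 2, h.eq_ab 2, h.eq_d 2, h.eq_c 2,
    h.eq_cd 1, h.eq_b 2, h.eq_bd 1, h.eq_bc 1,
    h.eq_a 2, h.three_ad, h.eq_ac 1, h.eq_ab 1, h.eq_d 1, h.eq_c 1, h.eq_cd 0,
    h.eq_b 1, h.eq_bd 0, h.eq_bc 0, h.eq_a 1, h.two_ad, h.eq_ac 0, h.eq_ab 0, h.zero,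
    h.one_ab, h.one_ac, ga, gb, gc, gd, g1, g3,
    hx.eq_d 2, hx.eq_c 2, hx.eq_cd 1, hx.eq_b 2, hx.eq_bd 1, hx.eq_bc 1, hx.eq_a 2, hx.three_ad,
    hx.eq_ac 1, hx.eq_ab 1, hx.eq_d 1, hx.eq_c 1, hx.eq_cd 0,
    hx.eq_b 1, hx.eq_bd 0, hx.eq_bc 0, hx.eq_a 1, hx.two_ad, hx.eq_ac 0, hx.eq_ab 0, hx.zero,
    hx.one_ab, hx.one_ac, xa, xb, xc, xd, x1, x3] <;> ring

lemma rotation (h : IsE1Recurrence a b c d q g) (hx : IsE1Recurrence b c d (a * q) q x) (k : ℕ) :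
    Rotation a b c d q g x k := by
  induction k using Nat.twoStepInduction with
  | zero => exact rotation_zero h hx
  | one => exact rotation_one h hx
  | more k r r' => exact rotation_step h hx r r'

end IsE1Recurrence

/-- The position of a colored part in the lexicographic order. -/
def partCode (x : ℕ × C10) : ℕ := 10 * x.1 + x.2.idx

lemma partCode_injective : Function.Injective partCode := by
  rintro ⟨k, p⟩ ⟨l, r⟩ h
  cases p <;> cases r <;> simp [partCode, C10.idx] at h ⊢ <;> omega

lemma GG_primary_iff {k : ℕ} {e : C10} (he : e.primary = true) (y : ℕ × C10) :
    GG (k + 1, e) y ↔ partCode y < 10 * k + e.idx + 1 := by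
  rcases y with ⟨l, r⟩
  cases e <;> simp [C10.primary] at he <;> cases r <;>
    simp [GG, Succ, partCode, C10.idx, C10.primary] <;> omega

lemma GG_secondary_iff {k : ℕ} {e : C10} (he : e.primary = false) (hcd : e ≠ .cd) (had : e ≠ .ad)
    (y : ℕ × C10) : GG (k + 1, e) y ↔ partCode y < 10 * k + e.idx := by
  rcases y with ⟨l, r⟩
  cases e <;> simp [C10.primary] at he hcd had <;> cases r <;>
    simp [GG, Succ, partCode, C10.idx, C10.primary] <;> omega

lemma GG_cd_iff {k : ℕ} (y : ℕ × C10) :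
    GG (k + 1, .cd) y ↔ partCode y < 10 * k + 7 ∨ y = (k + 1, .ab) := by
  rcases y with ⟨l, r⟩
  cases r <;> simp [GG, Succ, partCode, C10.idx, C10.primary] <;> omega

lemma GG_ad_iff {k : ℕ} (y : ℕ × C10) :
    GG (k + 1, .ad) y ↔ partCode y < 10 * k + 2 ∨ y = (k, .bc) := by
  rcases y with ⟨l, r⟩
  cases r <;> simp [GG, Succ, partCode, C10.idx, C10.primary] <;> omega

lemma partCode_lt_of_GG {x y : ℕ × C10} (h : GG x y) : partCode y < partCode x := by
  rcases x with ⟨k, p⟩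
  rcases y with ⟨l, r⟩
  cases p <;> cases r <;> simp [GG, Succ, partCode, C10.idx, C10.primary] at h ⊢ <;> omega

lemma inE1_iff (l : List (ℕ × C10)) : InE1 l ↔ (∀ x ∈ l, InPS x) ∧ l.IsChain GG ∧
    ∀ x y z : ℕ × C10, [x, y, z] <:+: l → ¬ Forbidden x y z := Iff.rfl

lemma inE1_nil : InE1 [] := by simp [inE1_iff]

lemma inE1_cons_iff (x : ℕ × C10) (l : List (ℕ × C10)) :
    InE1 (x :: l) ↔ InPS x ∧ InE1 l ∧ (∀ y ∈ l.head?, GG x y) ∧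
      ∀ y ∈ l.head?, ∀ z ∈ l.tail.head?, ¬ Forbidden x y z := by
  rw [inE1_iff, inE1_iff, List.forall_mem_cons, List.isChain_cons]
  have h3 : (∀ u v w : ℕ × C10, [u, v, w] <:+: x :: l → ¬ Forbidden u v w) ↔
      (∀ y ∈ l.head?, ∀ z ∈ l.tail.head?, ¬ Forbidden x y z) ∧
        ∀ u v w : ℕ × C10, [u, v, w] <:+: l → ¬ Forbidden u v w := by
    constructor
    · intro h
      refine ⟨?_, fun u v w huvw => h u v w (huvw.trans (List.suffix_cons x l).isInfix)⟩
      intro y hy z hz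
      rcases l with _ | ⟨y', _ | ⟨z', t⟩⟩ <;> simp at hy hz
      subst hy hz
      exact h _ _ _ (List.prefix_append [x, y', z'] t).isInfix
    · rintro ⟨h, h'⟩ u v w huvw
      rcases List.infix_cons_iff.1 huvw with hp | hi
      · obtain ⟨t, ht⟩ := hp
        simp only [List.cons_append, List.nil_append, List.cons.injEq] at ht
        obtain ⟨rfl, rfl⟩ := ht
        exact h v (by simp) w (by simp)
      · exact h' u v w hi
  rw [h3]
  tauto

/-- The partitions in `E₁` whose largest part, if any, has code less than `m`. -/
def E1Below (m : ℕ) : Set (List (ℕ × C10)) := {l | InE1 l ∧ ∀ x ∈ l.head?, partCode x < m}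

/-- The sequences that may follow the part `x` in a partition in `E₁`. -/
def E1Tails (x : ℕ × C10) : Set (List (ℕ × C10)) := {l | InE1 (x :: l)}

lemma E1Below_mono {m n : ℕ} (h : m ≤ n) : E1Below m ⊆ E1Below n :=
  fun _ hl => ⟨hl.1, fun x hx => (hl.2 x hx).trans_le h⟩

lemma E1Below_succ (x : ℕ × C10) :
    E1Below (partCode x + 1) = E1Below (partCode x) ∪ List.cons x '' E1Tails x := by
  ext l
  rcases l with _ | ⟨y, t⟩
  · simp [E1Below, inE1_nil]
  · simp only [E1Below, E1Tails, Set.mem_ofPred_eq, List.head?_cons, Option.mem_some_iff,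
      forall_eq', Set.mem_union, Set.mem_image, List.cons.injEq, exists_eq_right_right]
    constructor
    · rintro ⟨h, hy⟩
      rcases Nat.lt_succ_iff_lt_or_eq.1 hy with h' | h'
      · exact .inl ⟨h, h'⟩
      · obtain rfl := partCode_injective h'
        exact .inr ⟨h, rfl⟩
    · rintro (⟨h, hy⟩ | ⟨h, rfl⟩)
      · exact ⟨h, hy.trans (Nat.lt_succ_self _)⟩
      · exact ⟨h, Nat.lt_succ_self _⟩

lemma disjoint_E1Below_cons {m : ℕ} {x : ℕ × C10} (h : m ≤ partCode x)
    (s : Set (List (ℕ × C10))) : Disjoint (E1Below m) (List.cons x '' s) := by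
  rw [Set.disjoint_left]
  rintro _ ⟨-, hl⟩ ⟨t, -, rfl⟩
  exact absurd (hl x (by simp)) (by omega)

lemma E1Tails_subset (x : ℕ × C10) : E1Tails x ⊆ E1Below (partCode x) := by
  intro l hl
  obtain ⟨-, h, h', -⟩ := (inE1_cons_iff x l).1 hl
  exact ⟨h, fun y hy => partCode_lt_of_GG (h' y hy)⟩

lemma E1Tails_eq_empty {x : ℕ × C10} (h : ¬ InPS x) : E1Tails x = ∅ :=
  Set.eq_empty_of_forall_notMem fun l hl => h ((inE1_cons_iff x l).1 hl).1

lemma exists_partCode_eq (m : ℕ) : ∃ x, partCode x = m := by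
  have h : ∀ i < 10, ∃ e : C10, e.idx = i := by
    intro i hi
    interval_cases i
    exacts [⟨.ab, rfl⟩, ⟨.ac, rfl⟩, ⟨.ad, rfl⟩, ⟨.a, rfl⟩, ⟨.bc, rfl⟩, ⟨.bd, rfl⟩, ⟨.b, rfl⟩,
      ⟨.cd, rfl⟩, ⟨.c, rfl⟩, ⟨.d, rfl⟩]
  obtain ⟨e, he⟩ := h (m % 10) (Nat.mod_lt _ (by norm_num))
  exact ⟨(m / 10, e), by simp only [partCode, he]; omega⟩

lemma E1Below_zero : E1Below 0 = {[]} := by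
  ext l
  rcases l with _ | ⟨y, t⟩
  · simp [E1Below, inE1_nil]
  · simp only [E1Below, List.head?_cons, Option.mem_some_iff, forall_eq', not_lt_zero, and_false,
      Set.mem_ofPred_eq, Set.mem_singleton_iff, reduceCtorEq]

lemma E1Below_finite (m : ℕ) : (E1Below m).Finite := by
  induction m with
  | zero => simp [E1Below_zero]
  | succ m ih =>
    obtain ⟨x, rfl⟩ := exists_partCode_eq m
    rw [E1Below_succ]
    exact ih.union ((ih.subset (E1Tails_subset x)).image _)

lemma E1Tails_primary {e : C10} (he : e.primary = true) (k : ℕ) :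
    E1Tails (k + 1, e) = E1Below (10 * k + e.idx + 1) := by
  ext l
  simp only [E1Tails, E1Below, Set.mem_ofPred_eq, inE1_cons_iff, GG_primary_iff he]
  have h1 : InPS (k + 1, e) := by simp [InPS, he]
  have h2 : ∀ y z, ¬ Forbidden (k + 1, e) y z := by
    intro y z
    cases e <;> simp [C10.primary] at he <;> simp [Forbidden]
  simp [h1, h2]

lemma E1Tails_secondary {e : C10} (he : e.primary = false) (hcd : e ≠ .cd) (had : e ≠ .ad)
    (k : ℕ) : E1Tails (k + 2, e) = E1Below (10 * (k + 1) + e.idx) := by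
  ext l
  simp only [E1Tails, E1Below, Set.mem_ofPred_eq, inE1_cons_iff, GG_secondary_iff he hcd had]
  have h1 : InPS (k + 2, e) := by simp [InPS]
  have h2 : ∀ y z, ¬ Forbidden (k + 2, e) y z := by
    intro y z
    simp [Forbidden, hcd, had]
  simp [h1, h2]

lemma E1Tails_cd (k : ℕ) : E1Tails (k + 2, .cd) =
    E1Below (10 * (k + 1) + 7) ∪ List.cons (k + 2, .ab) '' E1Below (10 * k + 8) := by
  have h1 : InPS (k + 2, .cd) := by simp [InPS]
  have h1' : InPS (k + 2, .ab) := by simp [InPS]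
  ext l
  rcases l with _ | ⟨y, t⟩
  · simp [E1Tails, E1Below, inE1_cons_iff, inE1_nil, h1]
  by_cases hy : y = (k + 2, .ab)
  · subst hy
    have hB : (k + 2, C10.ab) :: t ∉ E1Below (10 * (k + 1) + 7) := by
      simp [E1Below, partCode, C10.idx]; omega
    have hG : ∀ z : ℕ × C10, (GG (k + 2, .ab) z ∧ ¬ Forbidden (k + 2, .cd) (k + 2, .ab) z) ↔
        partCode z < 10 * k + 8 := by
      rintro ⟨l, r⟩
      rw [GG_secondary_iff rfl (by simp) (by simp)]
      cases r <;> simp [Forbidden, partCode, C10.idx] <;> omega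
    have hcd : GG (k + 2, .cd) (k + 2, .ab) := by simp [GG_cd_iff]
    simp only [Set.mem_union, hB, false_or, Set.mem_image, List.cons.injEq, true_and,
      exists_eq_right]
    simp only [E1Tails, E1Below, Set.mem_ofPred_eq, inE1_cons_iff (k + 2, .cd),
      inE1_cons_iff (k + 2, .ab), h1, h1', ← hG, List.head?_cons, Option.mem_some_iff, forall_eq',
      List.tail_cons, hcd, true_and]
    have hF : ∀ y z, ¬ Forbidden (k + 2, .ab) y z := by simp [Forbidden]
    simp only [hF, not_false_eq_true, implies_true, and_true, forall_and]
    tauto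
  · have hF : ∀ z, ¬ (partCode y < 10 * (k + 1) + 7 ∧ Forbidden (k + 2, .cd) y z) := by
      rintro z ⟨-, -, h⟩
      simp at h
      exact hy (Prod.ext h.2.1.symm h.1)
    simp only [E1Tails, E1Below, Set.mem_ofPred_eq, inE1_cons_iff (k + 2, .cd), h1, GG_cd_iff, hy,
      List.head?_cons, Option.mem_some_iff, forall_eq', List.tail_cons, true_and, or_false,
      Set.mem_union, Set.mem_image, List.cons.injEq, Ne.symm hy, false_and, and_false,
      exists_false]
    grind

lemma E1Tails_two_ad : E1Tails (2, .ad) = E1Below 12 := by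
  have h1 : InPS (2, .ad) := by simp [InPS]
  ext l
  simp only [E1Tails, E1Below, Set.mem_ofPred_eq, inE1_cons_iff (2, .ad), h1, GG_ad_iff]
  rcases l with _ | ⟨y, t⟩
  · simp
  by_cases hy : y = (1, .bc)
  · subst hy
    have h2 : ¬ InPS (1, .bc) := by simp [InPS, C10.primary]
    simp [inE1_cons_iff (1, .bc), h2]
  · have hF : ∀ z, ¬ Forbidden (2, .ad) y z := by
      rintro z ⟨-, h⟩
      simp at h
      exact hy (Prod.ext (by omega) h.1)
    simp [hF, hy]

lemma E1Tails_ad (k : ℕ) : E1Tails (k + 3, .ad) = E1Below (10 * (k + 2) + 2) ∪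
    List.cons (k + 2, .bc) '' E1Below (10 * (k + 1) + if k = 0 then 4 else 3) := by
  have h1 : InPS (k + 3, .ad) := by simp [InPS]
  have h1' : InPS (k + 2, .bc) := by simp [InPS]
  ext l
  rcases l with _ | ⟨y, t⟩
  · simp [E1Tails, E1Below, inE1_cons_iff, inE1_nil, h1]
  by_cases hy : y = (k + 2, .bc)
  · subst hy
    have hB : (k + 2, C10.bc) :: t ∉ E1Below (10 * (k + 2) + 2) := by
      simp [E1Below, partCode, C10.idx]
    have hG : ∀ z : ℕ × C10, (GG (k + 2, .bc) z ∧ ¬ Forbidden (k + 3, .ad) (k + 2, .bc) z) ↔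
        partCode z < 10 * (k + 1) + if k = 0 then 4 else 3 := by
      rintro ⟨l, r⟩
      rw [GG_secondary_iff rfl (by simp) (by simp)]
      cases r <;> simp [Forbidden, partCode, C10.idx] <;> split_ifs <;> omega
    have had : GG (k + 3, .ad) (k + 2, .bc) := by simp [GG_ad_iff]
    simp only [Set.mem_union, hB, false_or, Set.mem_image, List.cons.injEq, true_and,
      exists_eq_right]
    simp only [E1Tails, E1Below, Set.mem_ofPred_eq, inE1_cons_iff (k + 3, .ad),
      inE1_cons_iff (k + 2, .bc), h1, h1', ← hG, List.head?_cons, Option.mem_some_iff, forall_eq',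
      List.tail_cons, had, true_and]
    have hF : ∀ y z, ¬ Forbidden (k + 2, .bc) y z := by simp [Forbidden]
    simp only [hF, not_false_eq_true, implies_true, and_true, forall_and]
    tauto
  · have hF : ∀ z, ¬ Forbidden (k + 3, .ad) y z := by
      rintro z ⟨-, h⟩
      simp at h
      exact hy (Prod.ext (by omega) h.1)
    simp only [E1Tails, E1Below, Set.mem_ofPred_eq, inE1_cons_iff (k + 3, .ad), h1, GG_ad_iff, hy,
      hF, List.head?_cons, Option.mem_some_iff, forall_eq', true_and, or_false, Set.mem_union,
      Set.mem_image, List.cons.injEq, Ne.symm hy, false_and, and_false, exists_false,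
      not_false_eq_true, implies_true, and_true]

section GeneratingFunction

variable {R : Type*} [CommRing R]

/-- The weight of a colored part: its size is marked by `q`, and each letter of its color by the
corresponding variable. -/
def partWeight (a b c d q : R) (x : ℕ × C10) : R :=
  (if x.2.hasA then a else 1) * (if x.2.hasB then b else 1) * (if x.2.hasC then c else 1) *
    (if x.2.hasD then d else 1) * q ^ x.1

/-- The weight of a sequence of colored parts. -/
def listWeight (a b c d q : R) (l : List (ℕ × C10)) : R := (l.map (partWeight a b c d q)).prod

lemma listWeight_eq (a b c d q : R) (l : List (ℕ × C10)) :
    listWeight a b c d q l =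
      a ^ l.countP (fun x => x.2.hasA) * b ^ l.countP (fun x => x.2.hasB) *
        c ^ l.countP (fun x => x.2.hasC) * d ^ l.countP (fun x => x.2.hasD) *
        q ^ (l.map Prod.fst).sum := by
  induction l with
  | nil => simp [listWeight]
  | cons x l ih =>
    have h (z : R) (p : Bool) (n : ℕ) :
        z ^ (n + if p then 1 else 0) = (if p then z else 1) * z ^ n := by
      cases p <;> simp [pow_succ']
    simp only [listWeight, List.map_cons, List.prod_cons] at ih ⊢
    simp only [ih, List.countP_cons, h, List.sum_cons, partWeight, pow_add]
    ring

/-- The sum of the weights of the partitions in `E₁` whose largest part has code less than `m`. -/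
noncomputable def E1GF (a b c d q : R) (m : ℕ) : R := ∑ᶠ l ∈ E1Below m, listWeight a b c d q l

variable (a b c d q : R)

lemma partWeight_ab (k : ℕ) : partWeight a b c d q (k, .ab) = a * b * q ^ k := by
  simp [partWeight, C10.hasA, C10.hasB, C10.hasC, C10.hasD]

lemma partWeight_ac (k : ℕ) : partWeight a b c d q (k, .ac) = a * c * q ^ k := by
  simp [partWeight, C10.hasA, C10.hasB, C10.hasC, C10.hasD]

lemma partWeight_ad (k : ℕ) : partWeight a b c d q (k, .ad) = a * d * q ^ k := by
  simp [partWeight, C10.hasA, C10.hasB, C10.hasC, C10.hasD]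

lemma partWeight_a (k : ℕ) : partWeight a b c d q (k, .a) = a * q ^ k := by
  simp [partWeight, C10.hasA, C10.hasB, C10.hasC, C10.hasD]

lemma partWeight_bc (k : ℕ) : partWeight a b c d q (k, .bc) = b * c * q ^ k := by
  simp [partWeight, C10.hasA, C10.hasB, C10.hasC, C10.hasD]

lemma partWeight_bd (k : ℕ) : partWeight a b c d q (k, .bd) = b * d * q ^ k := by
  simp [partWeight, C10.hasA, C10.hasB, C10.hasC, C10.hasD]

lemma partWeight_b (k : ℕ) : partWeight a b c d q (k, .b) = b * q ^ k := by
  simp [partWeight, C10.hasA, C10.hasB, C10.hasC, C10.hasD]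

lemma partWeight_cd (k : ℕ) : partWeight a b c d q (k, .cd) = c * d * q ^ k := by
  simp [partWeight, C10.hasA, C10.hasB, C10.hasC, C10.hasD]

lemma partWeight_c (k : ℕ) : partWeight a b c d q (k, .c) = c * q ^ k := by
  simp [partWeight, C10.hasA, C10.hasB, C10.hasC, C10.hasD]

lemma partWeight_d (k : ℕ) : partWeight a b c d q (k, .d) = d * q ^ k := by
  simp [partWeight, C10.hasA, C10.hasB, C10.hasC, C10.hasD]

lemma finsum_mem_cons_listWeight (x : ℕ × C10) {s : Set (List (ℕ × C10))} (hs : s.Finite) :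
    ∑ᶠ l ∈ List.cons x '' s, listWeight a b c d q l =
      partWeight a b c d q x * ∑ᶠ l ∈ s, listWeight a b c d q l := by
  rw [finsum_mem_image List.cons_injective.injOn, finsum_mem_eq_finite_toFinset_sum _ hs,
    finsum_mem_eq_finite_toFinset_sum _ hs, Finset.mul_sum]
  simp only [listWeight, List.map_cons, List.prod_cons]

lemma E1GF_succ (k : ℕ) (e : C10) :
    E1GF a b c d q (10 * k + e.idx + 1) = E1GF a b c d q (10 * k + e.idx) +
      partWeight a b c d q (k, e) * ∑ᶠ l ∈ E1Tails (k, e), listWeight a b c d q l := by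
  have hf := (E1Below_finite _).subset (E1Tails_subset (k, e))
  rw [← finsum_mem_cons_listWeight _ _ _ _ _ _ hf]
  exact (congrArg (fun s => ∑ᶠ l ∈ s, listWeight a b c d q l) (E1Below_succ (k, e))).trans
    (finsum_mem_union (disjoint_E1Below_cons le_rfl _) (E1Below_finite _) (hf.image _))

lemma E1GF_succ_primary (k : ℕ) {e : C10} (he : e.primary = true) :
    E1GF a b c d q (10 * (k + 1) + e.idx + 1) = E1GF a b c d q (10 * (k + 1) + e.idx) +
      partWeight a b c d q (k + 1, e) * E1GF a b c d q (10 * k + e.idx + 1) := by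
  rw [E1GF_succ, E1Tails_primary he, ← E1GF]

lemma E1GF_succ_secondary (k : ℕ) {e : C10} (he : e.primary = false) (hcd : e ≠ .cd)
    (had : e ≠ .ad) :
    E1GF a b c d q (10 * (k + 2) + e.idx + 1) = E1GF a b c d q (10 * (k + 2) + e.idx) +
      partWeight a b c d q (k + 2, e) * E1GF a b c d q (10 * (k + 1) + e.idx) := by
  rw [E1GF_succ, E1Tails_secondary he hcd had, ← E1GF]

lemma E1GF_succ_of_not_inPS {k : ℕ} {e : C10} (h : ¬ InPS (k, e)) :
    E1GF a b c d q (10 * k + e.idx + 1) = E1GF a b c d q (10 * k + e.idx) := by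
  rw [E1GF_succ, E1Tails_eq_empty h, finsum_mem_empty, mul_zero, add_zero]

lemma E1GF_succ_cd (k : ℕ) :
    E1GF a b c d q (10 * (k + 2) + 7 + 1) = E1GF a b c d q (10 * (k + 2) + 7) +
      partWeight a b c d q (k + 2, .cd) * (E1GF a b c d q (10 * (k + 1) + 7) +
        partWeight a b c d q (k + 2, .ab) * E1GF a b c d q (10 * k + 8)) := by
  refine (E1GF_succ a b c d q (k + 2) .cd).trans ?_
  rw [E1Tails_cd, finsum_mem_union (disjoint_E1Below_cons (by simp [partCode, C10.idx]; omega) _)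
    (E1Below_finite _) ((E1Below_finite _).image _),
    finsum_mem_cons_listWeight _ _ _ _ _ _ (E1Below_finite _)]
  rfl

lemma E1GF_succ_two_ad :
    E1GF a b c d q (10 * 2 + 2 + 1) = E1GF a b c d q (10 * 2 + 2) +
      partWeight a b c d q (2, .ad) * E1GF a b c d q (10 * 1 + 2) := by
  refine (E1GF_succ a b c d q 2 .ad).trans ?_
  rw [E1Tails_two_ad]
  rfl

lemma E1GF_succ_ad (k : ℕ) :
    E1GF a b c d q (10 * (k + 3) + 2 + 1) = E1GF a b c d q (10 * (k + 3) + 2) +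
      partWeight a b c d q (k + 3, .ad) * (E1GF a b c d q (10 * (k + 2) + 2) +
        partWeight a b c d q (k + 2, .bc) *
          E1GF a b c d q (10 * (k + 1) + if k = 0 then 4 else 3)) := by
  refine (E1GF_succ a b c d q (k + 3) .ad).trans ?_
  rw [E1Tails_ad, finsum_mem_union (disjoint_E1Below_cons (by simp [partCode, C10.idx]) _)
    (E1Below_finite _) ((E1Below_finite _).image _),
    finsum_mem_cons_listWeight _ _ _ _ _ _ (E1Below_finite _)]
  rfl

lemma E1GF_of_le_ten (i : ℕ) (hi : i ≤ 10) : E1GF a b c d q i = 1 := by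
  have h : E1Below i = {[]} := by
    ext l
    rcases l with _ | ⟨y, t⟩
    · simp [E1Below, inE1_nil]
    · simp only [E1Below, List.head?_cons, Option.mem_some_iff, forall_eq', Set.mem_ofPred_eq,
        Set.mem_singleton_iff, reduceCtorEq, iff_false, not_and, inE1_cons_iff]
      rintro ⟨⟨h, -⟩, -⟩
      simp only [partCode]
      omega
  simp [E1GF, h, listWeight]

lemma isE1Recurrence_E1GF :
    IsE1Recurrence a b c d q fun k e => E1GF a b c d q (10 * k + e.idx + 1) where
  zero e := E1GF_of_le_ten _ _ _ _ _ _ (by cases e <;> simp [C10.idx])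
  one_ab := (E1GF_succ_of_not_inPS a b c d q (by simp [InPS, C10.primary])).trans
    (E1GF_of_le_ten _ _ _ _ _ _ le_rfl)
  one_ac := ((E1GF_succ_of_not_inPS a b c d q (e := .ac) (by simp [InPS, C10.primary])).trans
    (E1GF_succ_of_not_inPS a b c d q (e := .ab) (by simp [InPS, C10.primary]))).trans
    (E1GF_of_le_ten _ _ _ _ _ _ le_rfl)
  one_ad := (((E1GF_succ_of_not_inPS a b c d q (e := .ad) (by simp [InPS, C10.primary])).trans
    (E1GF_succ_of_not_inPS a b c d q (e := .ac) (by simp [InPS, C10.primary]))).trans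
    (E1GF_succ_of_not_inPS a b c d q (e := .ab) (by simp [InPS, C10.primary]))).trans
    (E1GF_of_le_ten _ _ _ _ _ _ le_rfl)
  one_bc := E1GF_succ_of_not_inPS a b c d q (e := .bc) (by simp [InPS, C10.primary])
  one_bd := (E1GF_succ_of_not_inPS a b c d q (e := .bd) (by simp [InPS, C10.primary])).trans
    (E1GF_succ_of_not_inPS a b c d q (e := .bc) (by simp [InPS, C10.primary]))
  one_cd := E1GF_succ_of_not_inPS a b c d q (e := .cd) (by simp [InPS, C10.primary])
  eq_ab k :=
    (E1GF_succ_secondary a b c d q k (e := .ab) rfl (by simp) (by simp)).trans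
      (by rw [partWeight_ab]; rfl)
  eq_ac k :=
    (E1GF_succ_secondary a b c d q k (e := .ac) rfl (by simp) (by simp)).trans
      (by rw [partWeight_ac]; rfl)
  two_ad :=
    (E1GF_succ_two_ad a b c d q).trans
      (by rw [partWeight_ad]; rfl)
  three_ad :=
    (E1GF_succ_ad a b c d q 0).trans
      (by rw [partWeight_ad, partWeight_bc]; rfl)
  eq_ad k :=
    (E1GF_succ_ad a b c d q (k + 1)).trans
      (by rw [partWeight_ad, partWeight_bc]; rfl)
  eq_a k :=
    (E1GF_succ_primary a b c d q k (e := .a) rfl).trans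
      (by rw [partWeight_a]; rfl)
  eq_bc k :=
    (E1GF_succ_secondary a b c d q k (e := .bc) rfl (by simp) (by simp)).trans
      (by rw [partWeight_bc]; rfl)
  eq_bd k :=
    (E1GF_succ_secondary a b c d q k (e := .bd) rfl (by simp) (by simp)).trans
      (by rw [partWeight_bd]; rfl)
  eq_b k :=
    (E1GF_succ_primary a b c d q k (e := .b) rfl).trans
      (by rw [partWeight_b]; rfl)
  eq_cd k :=
    (E1GF_succ_cd a b c d q k).trans
      (by rw [partWeight_cd, partWeight_ab]; rfl)
  eq_c k :=
    (E1GF_succ_primary a b c d q k (e := .c) rfl).trans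
      (by rw [partWeight_c]; rfl)
  eq_d k :=
    (E1GF_succ_primary a b c d q k (e := .d) rfl).trans
      (by rw [partWeight_d]; rfl)

/-- Rotating the four variables multiplies the bounded generating function by `1 + a q` and raises
the bound. -/
lemma E1GF_rotation (k : ℕ) : (1 + a * q) * E1GF b c d (a * q) q (10 * (k + 3)) =
    E1GF a b c d q (10 * (k + 3) + 4) :=
  ((isE1Recurrence_E1GF a b c d q).rotation (isE1Recurrence_E1GF b c d (a * q) q) k).eq_d

end GeneratingFunction

section Limit

open Filter Topology Finset

/-- The number of letters occurring in the colors of a sequence of colored parts. -/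
def letterCount (l : List (ℕ × C10)) : ℕ :=
  l.countP (fun x => x.2.hasA) + l.countP (fun x => x.2.hasB) + l.countP (fun x => x.2.hasC) +
    l.countP (fun x => x.2.hasD)

lemma letterCount_eq_zero_iff (l : List (ℕ × C10)) : letterCount l = 0 ↔ l = [] := by
  rcases l with _ | ⟨⟨k, e⟩, l⟩
  · simp [letterCount]
  · cases e <;> simp [letterCount, C10.hasA, C10.hasB, C10.hasC, C10.hasD]

lemma listWeight_mul {R : Type*} [CommRing R] (a b c d q t : R) (l : List (ℕ × C10)) :
    listWeight (a * t) (b * t) (c * t) (d * t) q l =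
      t ^ letterCount l * listWeight a b c d q l := by
  simp only [listWeight_eq, letterCount, mul_pow, pow_add]
  ring

lemma norm_listWeight (a b c d q : ℂ) (l : List (ℕ × C10)) :
    ‖listWeight a b c d q l‖ = listWeight ‖a‖ ‖b‖ ‖c‖ ‖d‖ ‖q‖ l := by
  simp only [listWeight_eq, norm_mul, norm_pow]

lemma tendsto_listWeight {K : Type*} [NormedField K] (a b c d : K) {q : K} (hq : ‖q‖ < 1)
    (l : List (ℕ × C10)) :
    Tendsto (fun n : ℕ => listWeight (a * q ^ n) (b * q ^ n) (c * q ^ n) (d * q ^ n) q l) atTop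
      (𝓝 (if l = [] then 1 else 0)) := by
  simp only [listWeight_mul]
  split_ifs with h
  · simp [h, listWeight, letterCount]
  · have h0 := ((tendsto_pow_atTop_nhds_zero_of_norm_lt_one hq).pow (letterCount l)).mul_const
      (listWeight a b c d q l)
    rwa [zero_pow (mt (letterCount_eq_zero_iff l).1 h), zero_mul] at h0

lemma nil_mem_E1Below (m : ℕ) : [] ∈ E1Below m := by simp [E1Below, inE1_nil]

lemma tendsto_E1GF {K : Type*} [NormedField K] (a b c d : K) {q : K} (hq : ‖q‖ < 1) (m : ℕ) :
    Tendsto (fun n : ℕ => E1GF (a * q ^ n) (b * q ^ n) (c * q ^ n) (d * q ^ n) q m) atTop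
      (𝓝 1) := by
  simp only [E1GF, finsum_mem_eq_finite_toFinset_sum _ (E1Below_finite m)]
  have h := tendsto_finsetSum (E1Below_finite m).toFinset
    fun l _ => tendsto_listWeight a b c d hq l
  simpa [nil_mem_E1Below] using h

section Real

variable {a b c d q : ℝ}

lemma listWeight_nonneg (ha : 0 ≤ a) (hb : 0 ≤ b) (hc : 0 ≤ c) (hd : 0 ≤ d) (hq : 0 ≤ q)
    (l : List (ℕ × C10)) : 0 ≤ listWeight a b c d q l := by
  rw [listWeight_eq]
  positivity

lemma E1GF_mono (ha : 0 ≤ a) (hb : 0 ≤ b) (hc : 0 ≤ c) (hd : 0 ≤ d) (hq : 0 ≤ q) :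
    Monotone (E1GF a b c d q) := by
  intro m n h
  simp only [E1GF, finsum_mem_eq_finite_toFinset_sum _ (E1Below_finite _)]
  exact sum_le_sum_of_subset_of_nonneg (by simpa using E1Below_mono h)
    fun l _ _ => listWeight_nonneg ha hb hc hd hq l

lemma E1GF_le_rotate (ha : 0 ≤ a) (hb : 0 ≤ b) (hc : 0 ≤ c) (hd : 0 ≤ d) (hq : 0 ≤ q) (k : ℕ) :
    E1GF a b c d q (10 * (k + 3)) ≤
      Real.exp (a * q) * E1GF b c d (a * q) q (10 * (k + 3)) := by
  have h0 : 0 ≤ E1GF b c d (a * q) q (10 * (k + 3)) :=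
    finsum_nonneg fun l => finsum_nonneg fun _ =>
      listWeight_nonneg hb hc hd (by positivity) hq l
  calc E1GF a b c d q (10 * (k + 3))
      ≤ E1GF a b c d q (10 * (k + 3) + 4) := E1GF_mono ha hb hc hd hq (by omega)
    _ = (1 + a * q) * E1GF b c d (a * q) q (10 * (k + 3)) := (E1GF_rotation a b c d q k).symm
    _ ≤ _ := by
      gcongr
      linarith [Real.add_one_le_exp (a * q)]

lemma E1GF_le_scale (ha : 0 ≤ a) (hb : 0 ≤ b) (hc : 0 ≤ c) (hd : 0 ≤ d) (hq : 0 ≤ q) (k : ℕ) :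
    E1GF a b c d q (10 * (k + 3)) ≤ Real.exp ((a + b + c + d) * q) *
      E1GF (a * q) (b * q) (c * q) (d * q) q (10 * (k + 3)) := by
  have haq : 0 ≤ a * q := by positivity
  have hbq : 0 ≤ b * q := by positivity
  have hcq : 0 ≤ c * q := by positivity
  calc E1GF a b c d q (10 * (k + 3)) ≤ Real.exp (a * q) * (Real.exp (b * q) *
        (Real.exp (c * q) * (Real.exp (d * q) *
          E1GF (a * q) (b * q) (c * q) (d * q) q (10 * (k + 3))))) := by
        refine (E1GF_le_rotate ha hb hc hd hq k).trans ?_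
        gcongr
        refine (E1GF_le_rotate hb hc hd haq hq k).trans ?_
        gcongr
        refine (E1GF_le_rotate hc hd haq hbq hq k).trans ?_
        gcongr
        exact E1GF_le_rotate hd haq hbq hcq hq k
    _ = _ := by
      simp only [add_mul, Real.exp_add]
      ring

lemma E1GF_le_exp (ha : 0 ≤ a) (hb : 0 ≤ b) (hc : 0 ≤ c) (hd : 0 ≤ d) (hq : 0 ≤ q) (hq1 : q < 1)
    (k : ℕ) : E1GF a b c d q (10 * (k + 3)) ≤ Real.exp ((a + b + c + d) * (q / (1 - q))) := by
  have hq1' : 0 < 1 - q := by linarith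
  set s := (a + b + c + d) * (q / (1 - q)) with hs
  have key (n : ℕ) : E1GF a b c d q (10 * (k + 3)) ≤ Real.exp (s * (1 - q ^ n)) *
      E1GF (a * q ^ n) (b * q ^ n) (c * q ^ n) (d * q ^ n) q (10 * (k + 3)) := by
    induction n with
    | zero => simp
    | succ n ih =>
      refine ih.trans ?_
      have h := E1GF_le_scale (a := a * q ^ n) (b := b * q ^ n) (c := c * q ^ n) (d := d * q ^ n)
        (by positivity) (by positivity) (by positivity) (by positivity) hq k
      have he : s * (1 - q ^ (n + 1)) =
          s * (1 - q ^ n) + (a * q ^ n + b * q ^ n + c * q ^ n + d * q ^ n) * q := by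
        rw [hs]
        field_simp
        ring
      rw [he, Real.exp_add]
      simp only [pow_succ, ← mul_assoc] at h ⊢
      exact (mul_le_mul_of_nonneg_left h (Real.exp_pos _).le).trans_eq (mul_assoc _ _ _).symm
  have hlim := ((tendsto_pow_atTop_nhds_zero_of_lt_one hq hq1).const_sub 1).const_mul s |>.rexp.mul
    (tendsto_E1GF a b c d (by rwa [Real.norm_of_nonneg hq]) (10 * (k + 3)))
  rw [sub_zero, mul_one, mul_one] at hlim
  exact ge_of_tendsto' hlim key

end Real

/-- The partitions in `E₁` bounded by `m`, as a finite set of elements of `E₁`. -/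
noncomputable def E1BelowFinset (m : ℕ) : Finset {l // InE1 l} := by
  classical exact (E1Below_finite m).toFinset.subtype InE1

lemma mem_E1BelowFinset {m : ℕ} {l : {l // InE1 l}} : l ∈ E1BelowFinset m ↔ l.1 ∈ E1Below m := by
  simp [E1BelowFinset]

lemma sum_E1BelowFinset {R : Type*} [CommRing R] (a b c d q : R) (m : ℕ) :
    ∑ l ∈ E1BelowFinset m, listWeight a b c d q l.1 = E1GF a b c d q m := by
  classical
  rw [E1GF, finsum_mem_eq_finite_toFinset_sum _ (E1Below_finite _), E1BelowFinset,
    sum_subtype_eq_sum_filter, filter_true_of_mem]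
  exact fun l hl => ((E1Below_finite m).mem_toFinset.1 hl).1

lemma tendsto_E1BelowFinset : Tendsto E1BelowFinset atTop atTop := by
  refine tendsto_atTop_finset_of_monotone
    (fun m n h l hl => mem_E1BelowFinset.2 (E1Below_mono h (mem_E1BelowFinset.1 hl))) fun l => ?_
  rcases h : l.1.head? with _ | x
  · exact ⟨0, mem_E1BelowFinset.2 ⟨l.2, by simp [h]⟩⟩
  · exact ⟨partCode x + 1, mem_E1BelowFinset.2 ⟨l.2, by simp [h]⟩⟩

variable (a b c d : ℂ) {q : ℂ}

lemma summable_norm_listWeight (hq : ‖q‖ < 1) :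
    Summable fun l : {l // InE1 l} => ‖listWeight a b c d q l.1‖ := by
  refine summable_of_sum_le (fun _ => norm_nonneg _) (c := Real.exp ((‖a‖ + ‖b‖ + ‖c‖ + ‖d‖) *
    (‖q‖ / (1 - ‖q‖)))) fun u => ?_
  obtain ⟨m, hm⟩ := (tendsto_E1BelowFinset.eventually_ge_atTop u).exists
  have hmk : m ≤ 10 * (m + 3) := by omega
  calc ∑ l ∈ u, ‖listWeight a b c d q l.1‖
      ≤ ∑ l ∈ E1BelowFinset m, ‖listWeight a b c d q l.1‖ :=
        sum_le_sum_of_subset_of_nonneg hm fun _ _ _ => norm_nonneg _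
    _ = E1GF ‖a‖ ‖b‖ ‖c‖ ‖d‖ ‖q‖ m := by simp only [norm_listWeight, sum_E1BelowFinset]
    _ ≤ E1GF ‖a‖ ‖b‖ ‖c‖ ‖d‖ ‖q‖ (10 * (m + 3)) := E1GF_mono (norm_nonneg _) (norm_nonneg _)
        (norm_nonneg _) (norm_nonneg _) (norm_nonneg _) hmk
    _ ≤ _ := E1GF_le_exp (norm_nonneg _) (norm_nonneg _) (norm_nonneg _) (norm_nonneg _)
        (norm_nonneg _) hq m

/-- The generating function of the partitions in `E₁`. -/
noncomputable def E1Series (a b c d q : ℂ) : ℂ := ∑' l : {l // InE1 l}, listWeight a b c d q l.1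

lemma tendsto_E1GF_E1Series (hq : ‖q‖ < 1) :
    Tendsto (E1GF a b c d q) atTop (𝓝 (E1Series a b c d q)) := by
  have h := (summable_norm_listWeight a b c d hq).of_norm.hasSum.comp tendsto_E1BelowFinset
  exact h.congr fun m => sum_E1BelowFinset a b c d q m

lemma E1Series_rotate (hq : ‖q‖ < 1) :
    E1Series a b c d q = (1 + a * q) * E1Series b c d (a * q) q := by
  have h₁ : Tendsto (fun k : ℕ => 10 * (k + 3)) atTop atTop :=
    tendsto_atTop_mono (fun k => show k ≤ _ by omega) tendsto_id
  have h₂ : Tendsto (fun k : ℕ => 10 * (k + 3) + 4) atTop atTop :=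
    tendsto_atTop_mono (fun k => show k ≤ _ by omega) tendsto_id
  refine tendsto_nhds_unique ((tendsto_E1GF_E1Series a b c d hq).comp h₂) ?_
  refine (((tendsto_E1GF_E1Series b c d (a * q) hq).comp h₁).const_mul (1 + a * q)).congr
    fun k => ?_
  exact E1GF_rotation a b c d q k

lemma E1Series_eq_prod_range_mul (hq : ‖q‖ < 1) (n : ℕ) :
    E1Series a b c d q = (∏ k ∈ range n, (1 + a * q ^ (k + 1))) *
      (∏ k ∈ range n, (1 + b * q ^ (k + 1))) * (∏ k ∈ range n, (1 + c * q ^ (k + 1))) *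
        (∏ k ∈ range n, (1 + d * q ^ (k + 1))) *
          E1Series (a * q ^ n) (b * q ^ n) (c * q ^ n) (d * q ^ n) q := by
  induction n with
  | zero => simp
  | succ n ih =>
    rw [ih, E1Series_rotate _ _ _ _ hq, E1Series_rotate _ _ _ _ hq, E1Series_rotate _ _ _ _ hq,
      E1Series_rotate _ _ _ _ hq]
    simp only [prod_range_succ, pow_succ, mul_assoc]
    ring

lemma tendsto_E1Series (hq : ‖q‖ < 1) :
    Tendsto (fun n : ℕ => E1Series (a * q ^ n) (b * q ^ n) (c * q ^ n) (d * q ^ n) q) atTop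
      (𝓝 1) := by
  have h := tendsto_tsum_of_dominated_convergence (summable_norm_listWeight a b c d hq)
    (fun l : {l // InE1 l} => tendsto_listWeight a b c d hq l.1) (Eventually.of_forall fun n l => by
      rw [listWeight_mul, norm_mul, norm_pow, norm_pow]
      exact mul_le_of_le_one_left (norm_nonneg _)
        (pow_le_one₀ (by positivity) (pow_le_one₀ (norm_nonneg _) hq.le)))
  rwa [tsum_eq_single ⟨[], inE1_nil⟩ (fun l hl => if_neg fun h => hl (Subtype.ext h)),
    if_pos rfl] at h

lemma tendsto_prod_one_add_mul_pow (x : ℂ) (hq : ‖q‖ < 1) :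
    Tendsto (fun n => ∏ k ∈ range n, (1 + x * q ^ (k + 1))) atTop
      (𝓝 (∏' k : ℕ, (1 + x * q ^ (k + 1)))) := by
  refine (multipliable_one_add_of_summable ?_).hasProd.tendsto_prod_nat
  simp only [norm_mul, norm_pow, pow_succ, ← mul_assoc]
  exact ((summable_geometric_of_lt_one (norm_nonneg q) hq).mul_left ‖x‖).mul_right ‖q‖

lemma E1Series_eq_tprod (hq : ‖q‖ < 1) :
    E1Series a b c d q = (∏' k : ℕ, (1 + a * q ^ (k + 1))) * (∏' k : ℕ, (1 + b * q ^ (k + 1))) *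
      (∏' k : ℕ, (1 + c * q ^ (k + 1))) * ∏' k : ℕ, (1 + d * q ^ (k + 1)) := by
  have h := ((((tendsto_prod_one_add_mul_pow a hq).mul (tendsto_prod_one_add_mul_pow b hq)).mul
    (tendsto_prod_one_add_mul_pow c hq)).mul (tendsto_prod_one_add_mul_pow d hq)).mul
      (tendsto_E1Series a b c d hq)
  rw [mul_one] at h
  exact tendsto_nhds_unique
    (tendsto_const_nhds.congr fun n => E1Series_eq_prod_range_mul a b c d hq n) h

/-- The numbers of parts whose color contains `a`, `b`, `c`, `d`, and the sum of the sizes. -/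
def partStats (l : List (ℕ × C10)) : ℕ × ℕ × ℕ × ℕ × ℕ :=
  (l.countP (fun x => x.2.hasA), l.countP (fun x => x.2.hasB), l.countP (fun x => x.2.hasC),
    l.countP (fun x => x.2.hasD), (l.map Prod.fst).sum)

lemma card_partStats_fiber (x : ℕ × ℕ × ℕ × ℕ × ℕ) :
    Nat.card ((fun l : {l // InE1 l} => partStats l.1) ⁻¹' {x}) =
      BE1 x.1 x.2.1 x.2.2.1 x.2.2.2.1 x.2.2.2.2 := by
  refine Nat.card_congr ((Equiv.subtypeSubtypeEquivSubtypeInter InE1 (partStats · = x)).trans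
    (Equiv.subtypeEquivRight fun l => and_congr_right fun _ => ?_))
  simp only [partStats, Prod.ext_iff]
  tauto

lemma tsum_BE1_mul (hq : ‖q‖ < 1) :
    ∑' x : ℕ × ℕ × ℕ × ℕ × ℕ,
        (BE1 x.1 x.2.1 x.2.2.1 x.2.2.2.1 x.2.2.2.2 : ℂ) *
          a ^ x.1 * b ^ x.2.1 * c ^ x.2.2.1 * d ^ x.2.2.2.1 * q ^ x.2.2.2.2 =
      E1Series a b c d q := by
  rw [E1Series, ← ((summable_norm_listWeight a b c d hq).of_norm.hasSum.tsum_fiberwise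
    fun l => partStats l.1).tsum_eq]
  refine tsum_congr fun x => ?_
  rw [← card_partStats_fiber, tsum_congr (g := fun _ =>
    a ^ x.1 * b ^ x.2.1 * c ^ x.2.2.1 * d ^ x.2.2.2.1 * q ^ x.2.2.2.2), tsum_const, nsmul_eq_mul]
  · ring
  · rintro ⟨l, rfl⟩
    exact listWeight_eq a b c d q l.1

end Limit

/-- The identity
`∑ B(u,v,w,t,n) a^u b^v c^w d^t q^n = (−aq;q)_∞ (−bq;q)_∞ (−cq;q)_∞ (−dq;q)_∞`
for `|q| < 1` and `|a|, |b|, |c|, |d|` small. -/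
theorem main_theorem_series (a b c d q : ℂ) (hq : ‖q‖ < 1)
    (ha : ‖a‖ < 1) (hb : ‖b‖ < 1) (hc : ‖c‖ < 1) (hd : ‖d‖ < 1) :
    ∑' x : ℕ × ℕ × ℕ × ℕ × ℕ,
        (BE1 x.1 x.2.1 x.2.2.1 x.2.2.2.1 x.2.2.2.2 : ℂ) *
          a ^ x.1 * b ^ x.2.1 * c ^ x.2.2.1 * d ^ x.2.2.2.1 * q ^ x.2.2.2.2 =
      (∏' k : ℕ, (1 + a * q ^ (k + 1))) * (∏' k : ℕ, (1 + b * q ^ (k + 1))) *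
        (∏' k : ℕ, (1 + c * q ^ (k + 1))) * ∏' k : ℕ, (1 + d * q ^ (k + 1)) := by
  rw [tsum_BE1_mul a b c d hq, E1Series_eq_tprod a b c d hq]
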